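/- arXiv:math/0404162 — 3 statements merged into one kernel-verified Lean document; each statement's English description precedes it below -/
import Mathlib

section
/- Let V be a Klein four subgroup of SO(3). For every automorphism φ of V there exists an element g ∈ SO(3) such that φ(v) = g·v·g⁻¹ for all v ∈ V; that is, the normalizer of V in SO(3) surjects onto the automorphism group of V. -/
noncomputable section

/-- `SO3` is the group of 3×3 real orthogonal matrices of determinant one,
as a subgroup of the orthogonal group `O(3)`. -/
def SO3 : Subgroup ↥(Matrix.orthogonalGroup (Fin 3) ℝ) where
  carrier := {A | Matrix.det (A : Matrix (Fin 3) (Fin 3) ℝ) = 1}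
  one_mem' := by
    simp only [Set.mem_setOf_eq]
    norm_cast
    simp
  mul_mem' := by
    intro a b ha hb
    simp only [Set.mem_setOf_eq] at *
    push_cast
    rw [Matrix.det_mul, ha, hb, mul_one]
  inv_mem' := by
    intro a ha
    simp only [Set.mem_setOf_eq] at *
    have h : ((a⁻¹ * a : ↥(Matrix.orthogonalGroup (Fin 3) ℝ)) : Matrix (Fin 3) (Fin 3) ℝ)
        = ((1 : ↥(Matrix.orthogonalGroup (Fin 3) ℝ)) : Matrix (Fin 3) (Fin 3) ℝ) := by
      rw [inv_mul_cancel]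
    push_cast at h
    have := congrArg Matrix.det h
    rw [Matrix.det_mul, ha, mul_one, Matrix.det_one] at this
    exact this

open Matrix

/-- The Cayley–Hamilton identity for `3 × 3` matrices, solved for the adjugate. -/
theorem adjugate_fin_three_eq_sq_sub {R : Type*} [CommRing R] (A : Matrix (Fin 3) (Fin 3) R) :
    A.adjugate = A * A - A.trace • A + A.adjugate.trace • (1 : Matrix (Fin 3) (Fin 3) R) := by
  ext i j
  fin_cases i <;> fin_cases j <;>
    simp [adjugate_fin_three, trace_fin_three, mul_apply, Fin.sum_univ_three] <;> ring

/-- A nontrivial involution of determinant one in dimension three has trace `-1`. -/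
theorem trace_eq_neg_one_of_involution {K : Type*} [Field K] {A : Matrix (Fin 3) (Fin 3) K}
    (hsq : A * A = 1) (hdet : A.det = 1) (hA : A ≠ 1) : A.trace = -1 := by
  have hadj : A.adjugate = A := by
    calc A.adjugate = A.adjugate * (A * A) := by rw [hsq, mul_one]
      _ = A := by rw [← mul_assoc, adjugate_mul, hdet, one_smul, one_mul]
  have h := adjugate_fin_three_eq_sq_sub A
  rw [hadj, hsq] at h
  have h0 : (1 + A.trace) • (A - 1) = 0 := by
    rw [← sub_eq_zero] at h
    rw [← h]
    module
  rcases smul_eq_zero.1 h0 with h1 | h1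
  · linear_combination h1
  · exact absurd (sub_eq_zero.1 h1) hA

/-- A special orthogonal matrix in dimension three fixes a unit vector. -/
theorem exists_unit_mulVec_eq_self {A : Matrix (Fin 3) (Fin 3) ℝ}
    (horth : A * Aᵀ = 1) (hdet : A.det = 1) : ∃ u : Fin 3 → ℝ, u ⬝ᵥ u = 1 ∧ A *ᵥ u = u := by
  have h0 : (A - 1).det = 0 := by
    have h1 : A - 1 = -(A * (A - 1)ᵀ) := by
      rw [transpose_sub, transpose_one, mul_sub, horth, mul_one, neg_sub]
    have h2 := congrArg det h1
    rw [det_neg, det_mul, det_transpose, hdet] at h2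
    simp only [Fintype.card_fin] at h2
    linarith
  obtain ⟨v, hv, hAv⟩ := exists_mulVec_eq_zero_iff.2 h0
  rw [sub_mulVec, one_mulVec, sub_eq_zero] at hAv
  have hpos : 0 < v ⬝ᵥ v :=
    lt_of_le_of_ne (Finset.sum_nonneg fun i _ => mul_self_nonneg (v i))
      (Ne.symm (mt dotProduct_self_eq_zero.1 hv))
  refine ⟨(Real.sqrt (v ⬝ᵥ v))⁻¹ • v, ?_, ?_⟩
  · rw [smul_dotProduct, dotProduct_smul, smul_smul, ← mul_inv, Real.mul_self_sqrt hpos.le,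
      smul_eq_mul, inv_mul_cancel₀ hpos.ne']
  · rw [mulVec_smul, hAv]

/-- A nontrivial involution in `SO(3)` is the half-turn about some unit vector. -/
theorem exists_eq_halfTurn {A : Matrix (Fin 3) (Fin 3) ℝ} (horth : A * Aᵀ = 1)
    (hsq : A * A = 1) (hdet : A.det = 1) (hA : A ≠ 1) :
    ∃ u : Fin 3 → ℝ, u ⬝ᵥ u = 1 ∧ A = (2 : ℝ) • vecMulVec u u - 1 := by
  obtain ⟨u, hu, hAu⟩ := exists_unit_mulVec_eq_self horth hdet
  refine ⟨u, hu, ?_⟩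
  have hsymm : Aᵀ = A := by
    calc Aᵀ = A * A * Aᵀ := by rw [hsq, one_mul]
      _ = A := by rw [mul_assoc, horth, mul_one]
  have huA : u ᵥ* A = u := by rw [← mulVec_transpose, hsymm, hAu]
  have htr := trace_eq_neg_one_of_involution hsq hdet hA
  have hUU : vecMulVec u u * vecMulVec u u = vecMulVec u u := by
    rw [vecMulVec_mul_vecMulVec, hu, one_smul]
  have hAU : A * vecMulVec u u = vecMulVec u u := by rw [mul_vecMulVec, hAu]
  have hUA : vecMulVec u u * A = vecMulVec u u := by rw [vecMulVec_mul, huA]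
  set R := A + 1 - (2 : ℝ) • vecMulVec u u with hR
  have hRt : Rᵀ = R := by
    simp [hR, hsymm, transpose_vecMulVec]
  have hRR : R * R = (2 : ℝ) • R := by
    simp only [hR, mul_sub, sub_mul, mul_add, add_mul, smul_mul_assoc, mul_smul_comm, hUU, hAU,
      hUA, hsq, mul_one, one_mul]
    module
  have hRtr : R.trace = 0 := by
    simp only [hR, trace_sub, trace_add, trace_smul, trace_one, trace_vecMulVec, hu, htr]
    norm_num
  have hR0 : R = 0 := by
    rw [← trace_conjTranspose_mul_self_eq_zero_iff, conjTranspose_eq_transpose_of_trivial, hRt,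
      hRR, trace_smul, hRtr, smul_zero]
  rw [eq_sub_iff_add_eq, ← sub_eq_zero]
  exact hR0

/-- Axes of distinct commuting half-turns are orthogonal. -/
theorem dotProduct_eq_zero_of_commuting_halfTurns {u v : Fin 3 → ℝ} (hu : u ⬝ᵥ u = 1)
    (hv : v ⬝ᵥ v = 1) (hne : vecMulVec u u ≠ vecMulVec v v)
    (hcomm : vecMulVec u u * vecMulVec v v = vecMulVec v v * vecMulVec u u) : u ⬝ᵥ v = 0 := by
  by_contra hc
  have hvu : v ⬝ᵥ u = u ⬝ᵥ v := dotProduct_comm v u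
  have h1 : vecMulVec u v = vecMulVec v u := by
    rw [vecMulVec_mul_vecMulVec, vecMulVec_mul_vecMulVec, hvu] at hcomm
    simpa [hc] using hcomm
  apply hne
  have h2 := congrArg (fun M => vecMulVec u u * M) h1
  have h3 := congrArg (fun M => M * vecMulVec v v) h1
  simp only [vecMulVec_mul_vecMulVec, hu, hv, one_smul] at h2 h3
  rw [h2] at h3
  simpa [vecMulVec_smul, smul_vecMulVec, hc] using h3

/-- Some rotation carries a given orthonormal pair to the first two standard basis vectors. -/
theorem exists_SO3_mulVec_eq_single {u v : Fin 3 → ℝ} (hu : u ⬝ᵥ u = 1) (hv : v ⬝ᵥ v = 1)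
    (huv : u ⬝ᵥ v = 0) : ∃ q : ↥SO3,
      (q : Matrix (Fin 3) (Fin 3) ℝ) *ᵥ u = Pi.single 0 1 ∧
      (q : Matrix (Fin 3) (Fin 3) ℝ) *ᵥ v = Pi.single 1 1 := by
  have hvu : v ⬝ᵥ u = 0 := by rw [dotProduct_comm, huv]
  have hww : (u ⨯₃ v) ⬝ᵥ (u ⨯₃ v) = 1 := by
    rw [cross_dot_cross, hu, hv, huv, hvu]
    norm_num
  have hwu : (u ⨯₃ v) ⬝ᵥ u = 0 := by rw [dotProduct_comm, dot_self_cross]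
  have hwv : (u ⨯₃ v) ⬝ᵥ v = 0 := by rw [dotProduct_comm, dot_cross_self]
  have hdet : det ![u, v, u ⨯₃ v] = 1 := by
    rw [← triple_product_eq_det, triple_product_permutation, triple_product_permutation, hww]
  have horth : of ![u, v, u ⨯₃ v] * (of ![u, v, u ⨯₃ v])ᵀ = 1 := by
    ext i j
    change ![u, v, u ⨯₃ v] i ⬝ᵥ ![u, v, u ⨯₃ v] j = _
    fin_cases i <;> fin_cases j <;>
      simp [hu, hv, huv, hvu, hww, hwu, hwv, dot_self_cross, dot_cross_self]
  refine ⟨⟨⟨of ![u, v, u ⨯₃ v], (mem_orthogonalGroup_iff _ _).2 horth⟩, hdet⟩, ?_, ?_⟩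
  · ext i
    change ![u, v, u ⨯₃ v] i ⬝ᵥ u = _
    fin_cases i <;> simp [hu, hvu, hwu]
  · ext i
    change ![u, v, u ⨯₃ v] i ⬝ᵥ v = _
    fin_cases i <;> simp [hv, huv, hwv]

theorem SO3.coe_injective :
    Function.Injective fun a : ↥SO3 => (a : Matrix (Fin 3) (Fin 3) ℝ) :=
  Subtype.val_injective.comp Subtype.val_injective

theorem SO3.mul_transpose (a : ↥SO3) :
    (a : Matrix (Fin 3) (Fin 3) ℝ) * (a : Matrix (Fin 3) (Fin 3) ℝ)ᵀ = 1 :=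
  (mem_orthogonalGroup_iff _ _).1 a.1.2

/-- Conjugating the half-turn about `u` by `q` gives the half-turn about `q u`. -/
theorem SO3.conj_halfTurn {a q : ↥SO3} {u : Fin 3 → ℝ}
    (ha : (a : Matrix (Fin 3) (Fin 3) ℝ) = (2 : ℝ) • vecMulVec u u - 1) :
    ((q * a * q⁻¹ : ↥SO3) : Matrix (Fin 3) (Fin 3) ℝ) =
      (2 : ℝ) • vecMulVec ((q : Matrix (Fin 3) (Fin 3) ℝ) *ᵥ u)
        ((q : Matrix (Fin 3) (Fin 3) ℝ) *ᵥ u) - 1 := by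
  change (q : Matrix (Fin 3) (Fin 3) ℝ) * (a : Matrix (Fin 3) (Fin 3) ℝ) *
    (q : Matrix (Fin 3) (Fin 3) ℝ)ᵀ = _
  rw [ha, mul_sub, sub_mul, mul_one, SO3.mul_transpose, mul_smul_comm, smul_mul_assoc,
    mul_vecMulVec, vecMulVec_mul, vecMul_transpose]

/-- Two distinct commuting involutions in `SO(3)` are simultaneously conjugate to the half-turns
about the first two coordinate axes. -/
theorem SO3.exists_conj_eq_coordinate_halfTurns {a b : ↥SO3} (ha : a * a = 1) (hb : b * b = 1)
    (ha1 : a ≠ 1) (hb1 : b ≠ 1) (hab : a ≠ b) (hcomm : a * b = b * a) : ∃ q : ↥SO3,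
      ((q * a * q⁻¹ : ↥SO3) : Matrix (Fin 3) (Fin 3) ℝ) =
        (2 : ℝ) • vecMulVec (Pi.single 0 1) (Pi.single 0 1) - 1 ∧
      ((q * b * q⁻¹ : ↥SO3) : Matrix (Fin 3) (Fin 3) ℝ) =
        (2 : ℝ) • vecMulVec (Pi.single 1 1) (Pi.single 1 1) - 1 := by
  obtain ⟨u, hu, hau⟩ := exists_eq_halfTurn (SO3.mul_transpose a)
    (congrArg (fun x : ↥SO3 => (x : Matrix (Fin 3) (Fin 3) ℝ)) ha) a.2
    (SO3.coe_injective.ne ha1)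
  obtain ⟨v, hv, hbv⟩ := exists_eq_halfTurn (SO3.mul_transpose b)
    (congrArg (fun x : ↥SO3 => (x : Matrix (Fin 3) (Fin 3) ℝ)) hb) b.2
    (SO3.coe_injective.ne hb1)
  have hne : vecMulVec u u ≠ vecMulVec v v := fun h =>
    hab (SO3.coe_injective (by simp only [hau, hbv, h]))
  have hUV : vecMulVec u u * vecMulVec v v = vecMulVec v v * vecMulVec u u := by
    have h : (a : Matrix (Fin 3) (Fin 3) ℝ) * (b : Matrix (Fin 3) (Fin 3) ℝ) =
        (b : Matrix (Fin 3) (Fin 3) ℝ) * (a : Matrix (Fin 3) (Fin 3) ℝ) :=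
      congrArg (fun x : ↥SO3 => (x : Matrix (Fin 3) (Fin 3) ℝ)) hcomm
    simp only [hau, hbv, mul_sub, sub_mul, smul_mul_assoc, mul_smul_comm, mul_one, one_mul] at h
    have h4 : (4 : ℝ) • (vecMulVec u u * vecMulVec v v) =
        (4 : ℝ) • (vecMulVec v v * vecMulVec u u) := by
      rw [← sub_eq_zero] at h ⊢
      rw [← h]
      module
    exact smul_right_injective _ (by norm_num : (4 : ℝ) ≠ 0) h4
  obtain ⟨q, hqu, hqv⟩ := exists_SO3_mulVec_eq_single hu hv
    (dotProduct_eq_zero_of_commuting_halfTurns hu hv hne hUV)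
  exact ⟨q, by rw [SO3.conj_halfTurn hau, hqu], by rw [SO3.conj_halfTurn hbv, hqv]⟩

/-- Every automorphism of a Klein four subgroup of `SO(3)` is realized by conjugation by an
element of `SO(3)`: the normalizer of `V` surjects onto `Aut(V)`. -/
theorem klein_four_aut_realized_by_conjugation (V : Subgroup ↥SO3) (hV : IsKleinFour ↥V)
    (φ : ↥V ≃* ↥V) :
    ∃ g : ↥SO3, ∀ v : ↥V, ((φ v : ↥V) : ↥SO3) = g * (v : ↥SO3) * g⁻¹ := by
  have hsq (x : ↥V) : (x : ↥SO3) * x = 1 := congrArg Subtype.val (IsKleinFour.mul_self x)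
  have hcomm (x y : ↥V) : (x : ↥SO3) * y = y * x :=
    congrArg Subtype.val (IsKleinFour.isMulCommutative.is_comm.comm x y)
  have hone {x : ↥V} (hx : x ≠ 1) : (x : ↥SO3) ≠ 1 := fun h => hx (Subtype.ext h)
  obtain ⟨a, b, ha, hb, hab⟩ : ∃ a b : ↥V, a ≠ 1 ∧ b ≠ 1 ∧ a ≠ b := by
    obtain ⟨e⟩ := IsKleinFour.nonempty_mulEquiv (G₁ := DihedralGroup 2) (G₂ := ↥V)
    refine ⟨e (.r 1), e (.sr 0), ?_, ?_, e.injective.ne (by decide)⟩ <;>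
      exact fun h => absurd ((map_eq_one_iff e e.injective).1 h) (by decide)
  have key {x y : ↥V} (hx : x ≠ 1) (hy : y ≠ 1) (hxy : x ≠ y) :=
    SO3.exists_conj_eq_coordinate_halfTurns (hsq x) (hsq y) (hone hx) (hone hy)
      (Subtype.val_injective.ne hxy) (hcomm x y)
  obtain ⟨p, hpa, hpb⟩ := key ha hb hab
  obtain ⟨q, hqa, hqb⟩ := key (x := φ a) (y := φ b) (by simpa using ha) (by simpa using hb)
    (φ.injective.ne hab)
  have conj {x y : ↥SO3} (h : q * y * q⁻¹ = p * x * p⁻¹) : y = q⁻¹ * p * x * (q⁻¹ * p)⁻¹ := by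
    calc y = q⁻¹ * (q * y * q⁻¹) * q := by group
      _ = _ := by rw [h]; group
  have hA := conj (SO3.coe_injective (hqa.trans hpa.symm))
  have hB := conj (SO3.coe_injective (hqb.trans hpb.symm))
  refine ⟨q⁻¹ * p, fun v => ?_⟩
  by_cases hv : v = 1
  · simp [hv]
  by_cases hva : v = a
  · rw [hva, hA]
  by_cases hvb : v = b
  · rw [hvb, hB]
  rw [IsKleinFour.eq_mul_of_ne_all ha hb hab hv hva hvb, map_mul, Subgroup.coe_mul,
    Subgroup.coe_mul, hA, hB]
  group
end
end

section
/- Let G be a group and ρ: G → Sp(1) a projective representation whose image is exactly Q8 = {±1, ±i, ±j, ±k}. A group homomorphism χ: G → {±1} satisfies the condition that there exists w ∈ Sp(1) with χ(g)ρ(g) = w ρ(g) w⁻¹ for all g ∈ G if and only if χ = λ ∘ ρ for some group homomorphism λ: Q8 → {±1}. In particular, there are exactly four such homomorphisms χ. -/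
noncomputable section

open Quaternion

/-- A projective representation of `G` in the group `Sp(1)` of unit quaternions:
a function with values of norm one such that `ρ(gh)ρ(h)⁻¹ρ(g)⁻¹ ∈ {±1}`. -/
def IsProjRep {G : Type*} [Group G] (ρ : G → ℍ[ℝ]) : Prop :=
  (∀ g : G, ‖ρ g‖ = 1) ∧
    ∀ g h : G, ρ (g * h) * (ρ h)⁻¹ * (ρ g)⁻¹ = 1 ∨ ρ (g * h) * (ρ h)⁻¹ * (ρ g)⁻¹ = -1

/-- A homomorphism from `G` into the subgroup `{±1}` of unit quaternions. -/
def IsSignHom {G : Type*} [Group G] (χ : G → ℍ[ℝ]) : Prop :=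
  (∀ g : G, χ g = 1 ∨ χ g = -1) ∧ ∀ g h : G, χ (g * h) = χ g * χ h

/-- A projective representation `ρ` is irreducible if the centralizer of its image in `Sp(1)`
is `{±1}`. -/
def IsIrred {G : Type*} [Group G] (ρ : G → ℍ[ℝ]) : Prop :=
  ∀ q : ℍ[ℝ], ‖q‖ = 1 → (∀ g : G, q * ρ g = ρ g * q) → q = 1 ∨ q = -1

def qi : ℍ[ℝ] := ⟨0, 1, 0, 0⟩
def qj : ℍ[ℝ] := ⟨0, 0, 1, 0⟩
def qk : ℍ[ℝ] := ⟨0, 0, 0, 1⟩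

/-- The quaternion group `Q8 = {±1, ±i, ±j, ±k}` inside the unit quaternions. -/
def Q8 : Set ℍ[ℝ] := {1, -1, qi, -qi, qj, -qj, qk, -qk}

theorem qi_mul_qi : qi * qi = -1 := by ext <;> simp <;> simp [qi]
theorem qj_mul_qj : qj * qj = -1 := by ext <;> simp <;> simp [qj]
theorem qk_mul_qk : qk * qk = -1 := by ext <;> simp <;> simp [qk]
theorem qi_mul_qj : qi * qj = qk := by ext <;> simp <;> simp [qi, qj, qk]
theorem qj_mul_qi : qj * qi = -qk := by ext <;> simp <;> simp [qi, qj, qk]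
theorem qi_mul_qk : qi * qk = -qj := by ext <;> simp <;> simp [qi, qj, qk]
theorem qk_mul_qi : qk * qi = qj := by ext <;> simp <;> simp [qi, qj, qk]
theorem qj_mul_qk : qj * qk = qi := by ext <;> simp <;> simp [qi, qj, qk]
theorem qk_mul_qj : qk * qj = -qi := by ext <;> simp <;> simp [qi, qj, qk]

theorem norm_eq_one_of_mul_self_eq_neg_one {q : ℍ[ℝ]} (h : q * q = -1) : ‖q‖ = 1 := by
  have h' : ‖q‖ * ‖q‖ = 1 := by rw [← norm_mul, h, norm_neg, norm_one]
  nlinarith [norm_nonneg q]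

theorem norm_eq_one_of_mem_Q8 {q : ℍ[ℝ]} (hq : q ∈ Q8) : ‖q‖ = 1 := by
  have hi := norm_eq_one_of_mul_self_eq_neg_one qi_mul_qi
  have hj := norm_eq_one_of_mul_self_eq_neg_one qj_mul_qj
  have hk := norm_eq_one_of_mul_self_eq_neg_one qk_mul_qk
  rcases hq with rfl | rfl | rfl | rfl | rfl | rfl | rfl | rfl <;> simp [hi, hj, hk]

theorem ne_zero_of_norm_eq_one {q : ℍ[ℝ]} (hq : ‖q‖ = 1) : q ≠ 0 := by
  rintro rfl
  simp at hq

theorem mul_comm_or_anticomm_of_mem_Q8 {w q : ℍ[ℝ]} (hw : w ∈ Q8) (hq : q ∈ Q8) :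
    w * q = q * w ∨ w * q = -(q * w) := by
  rcases hw with rfl | rfl | rfl | rfl | rfl | rfl | rfl | rfl <;>
    rcases hq with rfl | rfl | rfl | rfl | rfl | rfl | rfl | rfl <;>
    simp [qi_mul_qj, qj_mul_qi, qi_mul_qk, qk_mul_qi, qj_mul_qk, qk_mul_qj]

/-- The factor by which conjugation by `w` changes `q`. -/
def conjFactor (w q : ℍ[ℝ]) : ℍ[ℝ] := w * q * w⁻¹ * q⁻¹

theorem conjFactor_eq_iff {w q : ℍ[ℝ]} (hq : q ≠ 0) (c : ℍ[ℝ]) :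
    conjFactor w q = c ↔ w * q * w⁻¹ = c * q :=
  mul_inv_eq_iff_eq_mul₀ hq

theorem conjFactor_mul_self {w q : ℍ[ℝ]} (hq : q ≠ 0) :
    conjFactor w q * q = w * q * w⁻¹ :=
  ((conjFactor_eq_iff hq _).1 rfl).symm

theorem conjFactor_eq_one {w q : ℍ[ℝ]} (hw : w ≠ 0) (hq : q ≠ 0) (h : w * q = q * w) :
    conjFactor w q = 1 := by
  rw [conjFactor_eq_iff hq, h, mul_inv_cancel_right₀ hw, one_mul]

theorem conjFactor_eq_neg_one {w q : ℍ[ℝ]} (hw : w ≠ 0) (hq : q ≠ 0) (h : w * q = -(q * w)) :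
    conjFactor w q = -1 := by
  rw [conjFactor_eq_iff hq, h, neg_mul, mul_inv_cancel_right₀ hw, neg_one_mul]

theorem conjFactor_neg (w q : ℍ[ℝ]) : conjFactor w (-q) = conjFactor w q := by
  simp [conjFactor, inv_neg]

theorem conjFactor_mul {w q q' : ℍ[ℝ]} (hw : w ≠ 0) (hq : q ≠ 0) (hq' : q' ≠ 0)
    (h' : conjFactor w q' = 1 ∨ conjFactor w q' = -1) :
    conjFactor w (q * q') = conjFactor w q * conjFactor w q' := by
  have hcomm : conjFactor w q' * q = q * conjFactor w q' := by
    rcases h' with h | h <;> simp [h]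
  rw [conjFactor_eq_iff (mul_ne_zero hq hq')]
  calc w * (q * q') * w⁻¹ = (w * q * w⁻¹) * (w * q' * w⁻¹) := by
        simp [mul_assoc, inv_mul_cancel_left₀ hw]
    _ = conjFactor w q * (q * conjFactor w q') * q' := by
        rw [← conjFactor_mul_self hq, ← conjFactor_mul_self hq']
        simp only [mul_assoc]
    _ = conjFactor w q * conjFactor w q' * (q * q') := by
        rw [← hcomm]
        simp only [mul_assoc]

/-- `lam` restricts to a homomorphism from `Q8` to `{±1}`. -/
def IsSignCharQ8 (lam : ℍ[ℝ] → ℍ[ℝ]) : Prop :=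
  (∀ q ∈ Q8, lam q = 1 ∨ lam q = -1) ∧
    ∀ q ∈ Q8, ∀ q' ∈ Q8, lam (q * q') = lam q * lam q'

theorem isSignCharQ8_conjFactor_of_sign {w : ℍ[ℝ]} (hw : w ≠ 0)
    (h : ∀ q ∈ Q8, conjFactor w q = 1 ∨ conjFactor w q = -1) : IsSignCharQ8 (conjFactor w) :=
  ⟨h, fun _ hq q' hq' => conjFactor_mul hw (ne_zero_of_norm_eq_one (norm_eq_one_of_mem_Q8 hq))
    (ne_zero_of_norm_eq_one (norm_eq_one_of_mem_Q8 hq')) (h q' hq')⟩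

theorem isSignCharQ8_conjFactor {w : ℍ[ℝ]} (hw : w ∈ Q8) : IsSignCharQ8 (conjFactor w) := by
  have hw0 := ne_zero_of_norm_eq_one (norm_eq_one_of_mem_Q8 hw)
  refine isSignCharQ8_conjFactor_of_sign hw0 fun q hq => ?_
  have hq0 := ne_zero_of_norm_eq_one (norm_eq_one_of_mem_Q8 hq)
  exact (mul_comm_or_anticomm_of_mem_Q8 hw hq).imp (conjFactor_eq_one hw0 hq0)
    (conjFactor_eq_neg_one hw0 hq0)

theorem IsSignCharQ8.eqOn {lam lam' : ℍ[ℝ] → ℍ[ℝ]} (h : IsSignCharQ8 lam)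
    (h' : IsSignCharQ8 lam') (hi : lam qi = lam' qi) (hj : lam qj = lam' qj) :
    Set.EqOn lam lam' Q8 := by
  have mul {a b : ℍ[ℝ]} (ha : a ∈ Q8) (hb : b ∈ Q8) (hab : lam a = lam' a)
      (hab' : lam b = lam' b) : lam (a * b) = lam' (a * b) := by
    rw [h.2 a ha b hb, h'.2 a ha b hb, hab, hab']
  have mi : qi ∈ Q8 := by simp [Q8]
  have mj : qj ∈ Q8 := by simp [Q8]
  have mk : qk ∈ Q8 := by simp [Q8]
  have mn : (-1 : ℍ[ℝ]) ∈ Q8 := by simp [Q8]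
  have hn : lam (-1) = lam' (-1) := qi_mul_qi ▸ mul mi mi hi hi
  have hk : lam qk = lam' qk := qi_mul_qj ▸ mul mi mj hi hj
  rintro _ (rfl | rfl | rfl | rfl | rfl | rfl | rfl | rfl)
  · simpa using mul mn mn hn hn
  · exact hn
  · exact hi
  · simpa using mul mn mi hn hi
  · exact hj
  · simpa using mul mn mj hn hj
  · exact hk
  · simpa using mul mn mk hn hk

theorem conjFactor_one_left {q : ℍ[ℝ]} (hq : q ≠ 0) : conjFactor 1 q = 1 :=
  conjFactor_eq_one one_ne_zero hq (by simp)

theorem qi_ne_zero : qi ≠ 0 :=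
  ne_zero_of_norm_eq_one (norm_eq_one_of_mul_self_eq_neg_one qi_mul_qi)

theorem qj_ne_zero : qj ≠ 0 :=
  ne_zero_of_norm_eq_one (norm_eq_one_of_mul_self_eq_neg_one qj_mul_qj)

theorem qk_ne_zero : qk ≠ 0 :=
  ne_zero_of_norm_eq_one (norm_eq_one_of_mul_self_eq_neg_one qk_mul_qk)

theorem conjFactor_qi_qi : conjFactor qi qi = 1 :=
  conjFactor_eq_one qi_ne_zero qi_ne_zero rfl

theorem conjFactor_qi_qj : conjFactor qi qj = -1 :=
  conjFactor_eq_neg_one qi_ne_zero qj_ne_zero (by simp [qi_mul_qj, qj_mul_qi])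

theorem conjFactor_qj_qi : conjFactor qj qi = -1 :=
  conjFactor_eq_neg_one qj_ne_zero qi_ne_zero (by simp [qi_mul_qj, qj_mul_qi])

theorem conjFactor_qj_qj : conjFactor qj qj = 1 :=
  conjFactor_eq_one qj_ne_zero qj_ne_zero rfl

theorem conjFactor_qk_qi : conjFactor qk qi = -1 :=
  conjFactor_eq_neg_one qk_ne_zero qi_ne_zero (by simp [qi_mul_qk, qk_mul_qi])

theorem conjFactor_qk_qj : conjFactor qk qj = -1 :=
  conjFactor_eq_neg_one qk_ne_zero qj_ne_zero (by simp [qj_mul_qk, qk_mul_qj])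

/-- Representatives of the four classes of `Q8` modulo its center. -/
def Q8Reps : Set ℍ[ℝ] := {1, qi, qj, qk}

theorem Q8Reps_subset : Q8Reps ⊆ Q8 := by
  rintro q (rfl | rfl | rfl | rfl) <;> simp [Q8]

theorem IsSignCharQ8.exists_eqOn_conjFactor {lam : ℍ[ℝ] → ℍ[ℝ]} (h : IsSignCharQ8 lam) :
    ∃ w ∈ Q8Reps, Set.EqOn lam (conjFactor w) Q8 := by
  suffices ∃ w ∈ Q8Reps, lam qi = conjFactor w qi ∧ lam qj = conjFactor w qj by
    obtain ⟨w, hw, hi, hj⟩ := this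
    exact ⟨w, hw, h.eqOn (isSignCharQ8_conjFactor (Q8Reps_subset hw)) hi hj⟩
  rcases h.1 qi (by simp [Q8]) with hi | hi <;> rcases h.1 qj (by simp [Q8]) with hj | hj
  · exact ⟨1, by simp [Q8Reps], by
      simp [hi, hj, conjFactor_one_left qi_ne_zero, conjFactor_one_left qj_ne_zero]⟩
  · exact ⟨qi, by simp [Q8Reps], by simp [hi, hj, conjFactor_qi_qi, conjFactor_qi_qj]⟩
  · exact ⟨qj, by simp [Q8Reps], by simp [hi, hj, conjFactor_qj_qi, conjFactor_qj_qj]⟩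
  · exact ⟨qk, by simp [Q8Reps], by simp [hi, hj, conjFactor_qk_qi, conjFactor_qk_qj]⟩

theorem eq_of_conjFactor_eq {w w' : ℍ[ℝ]} (hw : w ∈ Q8Reps) (hw' : w' ∈ Q8Reps)
    (hi : conjFactor w qi = conjFactor w' qi) (hj : conjFactor w qj = conjFactor w' qj) :
    w = w' := by
  have h1 : (1 : ℍ[ℝ]) ≠ -1 := fun h => by
    have := congrArg (·.re) h
    norm_num at this
  rcases hw with rfl | rfl | rfl | rfl <;> rcases hw' with rfl | rfl | rfl | rfl <;>
    first
    | rfl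
    | simp [h1, h1.symm, conjFactor_one_left qi_ne_zero, conjFactor_one_left qj_ne_zero,
        conjFactor_qi_qi, conjFactor_qi_qj, conjFactor_qj_qi, conjFactor_qj_qj,
        conjFactor_qk_qi, conjFactor_qk_qj] at hi hj

theorem ncard_Q8Reps : Q8Reps.ncard = 4 := by
  rw [Q8Reps]
  repeat rw [Set.ncard_insert_of_notMem (by
    simp only [Set.mem_insert_iff, Set.mem_singleton_iff, Quaternion.ext_iff]
    simp [qi, qj, qk])]
  simp

theorem IsProjRep.map_mul {G : Type*} [Group G] {ρ : G → ℍ[ℝ]} (hρ : IsProjRep ρ) (g h : G) :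
    ρ (g * h) = ρ g * ρ h ∨ ρ (g * h) = -(ρ g * ρ h) := by
  have hg := ne_zero_of_norm_eq_one (hρ.1 g)
  have hh := ne_zero_of_norm_eq_one (hρ.1 h)
  refine (hρ.2 g h).imp (fun e => ?_) fun e => ?_ <;>
    simpa [mul_inv_eq_iff_eq_mul₀ hg, mul_inv_eq_iff_eq_mul₀ hh] using e

theorem IsSignCharQ8.isSignHom_conjFactor_comp {G : Type*} [Group G] {ρ : G → ℍ[ℝ]}
    (hρ : IsProjRep ρ) (hQ : ∀ g, ρ g ∈ Q8) {w : ℍ[ℝ]} (h : IsSignCharQ8 (conjFactor w)) :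
    IsSignHom fun g => conjFactor w (ρ g) := by
  refine ⟨fun g => h.1 _ (hQ g), fun g g' => ?_⟩
  rw [← h.2 _ (hQ g) _ (hQ g')]
  rcases hρ.map_mul g g' with e | e <;> simp only [e, conjFactor_neg]

theorem isSignCharQ8_conjFactor_of_twist {G : Type*} [Group G] {ρ χ : G → ℍ[ℝ]}
    (hrange : Set.range ρ = Q8) (hχ : IsSignHom χ) {w : ℍ[ℝ]} (hw : ‖w‖ = 1)
    (h : ∀ g, χ g = conjFactor w (ρ g)) : IsSignCharQ8 (conjFactor w) := by
  refine isSignCharQ8_conjFactor_of_sign (ne_zero_of_norm_eq_one hw) fun q hq => ?_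
  obtain ⟨g, rfl⟩ := hrange.ge hq
  rw [← h]
  exact hχ.1 g

/-- For a projective representation `ρ` with image exactly `Q8`, a sign homomorphism `χ`
twists `ρ` into a conjugate representation if and only if `χ = λ ∘ ρ` for some homomorphism
`λ : Q8 → {±1}`; in particular there are exactly four such `χ`. -/
theorem twists_of_Q8_rep {G : Type*} [Group G] (ρ : G → ℍ[ℝ]) (hρ : IsProjRep ρ)
    (hrange : Set.range ρ = Q8) :
    (∀ χ : G → ℍ[ℝ], IsSignHom χ →
      ((∃ w : ℍ[ℝ], ‖w‖ = 1 ∧ ∀ g : G, χ g * ρ g = w * ρ g * w⁻¹) ↔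
        (∃ lam : ℍ[ℝ] → ℍ[ℝ], (∀ q ∈ Q8, lam q = 1 ∨ lam q = -1) ∧
          (∀ q ∈ Q8, ∀ q' ∈ Q8, lam (q * q') = lam q * lam q') ∧
          ∀ g : G, χ g = lam (ρ g)))) ∧
    {χ : G → ℍ[ℝ] | IsSignHom χ ∧
      ∃ w : ℍ[ℝ], ‖w‖ = 1 ∧ ∀ g : G, χ g * ρ g = w * ρ g * w⁻¹}.ncard = 4 := by
  have hQ : ∀ g, ρ g ∈ Q8 := fun g => hrange.le ⟨g, rfl⟩
  have twist_iff (χ : G → ℍ[ℝ]) (w : ℍ[ℝ]) :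
      (∀ g, χ g * ρ g = w * ρ g * w⁻¹) ↔ ∀ g, χ g = conjFactor w (ρ g) :=
    forall_congr' fun g => by
      rw [eq_comm, ← conjFactor_eq_iff (ne_zero_of_norm_eq_one (hρ.1 g)), eq_comm]
  simp only [twist_iff]
  constructor
  · refine fun χ hχ => ⟨fun ⟨w, hw, h⟩ => ?_, fun ⟨lam, hsign, hmul, h⟩ => ?_⟩
    · obtain ⟨hsign, hmul⟩ := isSignCharQ8_conjFactor_of_twist hrange hχ hw h
      exact ⟨conjFactor w, hsign, hmul, h⟩
    · obtain ⟨w, hw, e⟩ := IsSignCharQ8.exists_eqOn_conjFactor ⟨hsign, hmul⟩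
      exact ⟨w, norm_eq_one_of_mem_Q8 (Q8Reps_subset hw), fun g => (h g).trans (e (hQ g))⟩
  · have himage : {χ : G → ℍ[ℝ] | IsSignHom χ ∧
        ∃ w : ℍ[ℝ], ‖w‖ = 1 ∧ ∀ g : G, χ g = conjFactor w (ρ g)} =
        (fun w g => conjFactor w (ρ g)) '' Q8Reps := by
      ext χ
      constructor
      · rintro ⟨hχ, w, hw, h⟩
        obtain ⟨v, hv, e⟩ :=
          (isSignCharQ8_conjFactor_of_twist hrange hχ hw h).exists_eqOn_conjFactor
        exact ⟨v, hv, funext fun g => ((h g).trans (e (hQ g))).symm⟩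
      · rintro ⟨w, hw, rfl⟩
        have hw' := Q8Reps_subset hw
        exact ⟨(isSignCharQ8_conjFactor hw').isSignHom_conjFactor_comp hρ hQ,
          w, norm_eq_one_of_mem_Q8 hw', fun _ => rfl⟩
    rw [himage, Set.InjOn.ncard_image, ncard_Q8Reps]
    intro w hw w' hw' h
    obtain ⟨gi, hgi⟩ : qi ∈ Set.range ρ := by simp [hrange, Q8]
    obtain ⟨gj, hgj⟩ : qj ∈ Set.range ρ := by simp [hrange, Q8]
    exact eq_of_conjFactor_eq hw hw' (by simpa only [hgi] using congrFun h gi)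
      (by simpa only [hgj] using congrFun h gj)
end
end

section
/- Let w be an element of the second exterior power ⋀²(ℤ⁴) of the free ℤ-module ℤ⁴. Then the mod-2 reduction of w in ⋀²((ℤ/2)⁴) is decomposable (i.e., equal to x ∧ y for some x, y ∈ (ℤ/2)⁴) if and only if w ∧ w lies in 4·⋀⁴(ℤ⁴). -/
noncomputable section

/-- The mod-2 reduction `ℤ⁴ → (ℤ/2)⁴`, as a `ℤ`-linear map. -/
def red24 : (Fin 4 → ℤ) →ₗ[ℤ] (Fin 4 → ZMod 2) :=
  LinearMap.pi fun i => (Int.castAddHom (ZMod 2)).toIntLinearMap.comp (LinearMap.proj i)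

/-- The algebra map `⋀(ℤ⁴) → ⋀((ℤ/2)⁴)` induced by mod-2 reduction; on `⋀²` it is the
mod-2 reduction map `⋀²(ℤ⁴) → ⋀²((ℤ/2)⁴)`. -/
def redEA : ExteriorAlgebra ℤ (Fin 4 → ℤ) →ₐ[ℤ] ExteriorAlgebra (ZMod 2) (Fin 4 → ZMod 2) :=
  ExteriorAlgebra.lift ℤ
    ⟨((ExteriorAlgebra.ι (ZMod 2) :
          (Fin 4 → ZMod 2) →ₗ[ZMod 2] ExteriorAlgebra (ZMod 2) (Fin 4 → ZMod 2)).toAddMonoidHom.comp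
        red24.toAddMonoidHom).toIntLinearMap,
      fun _ => ExteriorAlgebra.ι_sq_zero _⟩

namespace ExteriorAlgebra

variable {R : Type*} [CommRing R]

/-- The `i`-th standard basis vector of `R⁴`, in the exterior algebra. -/
def stdGen (R : Type*) [CommRing R] (i : Fin 4) : ExteriorAlgebra R (Fin 4 → R) :=
  ι R (Pi.single i 1)

/-- The bivector in `⋀²(R⁴)` with coordinates `a, b, c, d, f, g` along
`e₀₁, e₀₂, e₀₃, e₁₂, e₁₃, e₂₃`. -/
def bivector (a b c d f g : R) : ExteriorAlgebra R (Fin 4 → R) :=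
  a • (stdGen R 0 * stdGen R 1) + b • (stdGen R 0 * stdGen R 2) + c • (stdGen R 0 * stdGen R 3) +
    d • (stdGen R 1 * stdGen R 2) + f • (stdGen R 1 * stdGen R 3) + g • (stdGen R 2 * stdGen R 3)

/-- The minor with columns `s` of an `n`-vector in `R⁴`, as a linear form. -/
def minor {n : ℕ} (s : Fin n → Fin 4) : ExteriorAlgebra R (Fin 4 → R) →ₗ[R] R :=
  liftAlternating (Pi.single n (Matrix.detRowAlternating.compLinearMap (LinearMap.funLeft R R s)))

lemma minor_ιMulti {n : ℕ} (s : Fin n → Fin 4) (v : Fin n → Fin 4 → R) :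
    minor s (ιMulti R n v) = Matrix.det (Matrix.of fun i j => v i (s j)) := by
  rw [minor, liftAlternating_apply_ιMulti, Pi.single_eq_same]
  rfl

lemma minor_ι_mul_ι (i j : Fin 4) (x y : Fin 4 → R) :
    minor ![i, j] (ι R x * ι R y) = x i * y j - x j * y i := by
  have : ι R x * ι R y = ιMulti R 2 ![x, y] := by simp [ιMulti_apply]
  rw [this, minor_ιMulti]
  simp [Matrix.det_fin_two]

lemma stdGen_mul_self (i : Fin 4) : stdGen R i * stdGen R i = 0 :=
  ι_sq_zero _

lemma stdGen_mul_stdGen_mul_self (i : Fin 4) (z : ExteriorAlgebra R (Fin 4 → R)) :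
    stdGen R i * (stdGen R i * z) = 0 := by
  rw [← mul_assoc, stdGen_mul_self, zero_mul]

/-- The hypothesis `j < i` makes this a terminating rewrite rule. -/
lemma stdGen_mul_of_lt {i j : Fin 4} (_ : j < i) :
    stdGen R i * stdGen R j = -(stdGen R j * stdGen R i) :=
  eq_neg_of_add_eq_zero_left (ι_add_mul_swap _ _)

lemma stdGen_mul_stdGen_mul_of_lt {i j : Fin 4} (h : j < i)
    (z : ExteriorAlgebra R (Fin 4 → R)) :
    stdGen R i * (stdGen R j * z) = -(stdGen R j * (stdGen R i * z)) := by
  rw [← mul_assoc, stdGen_mul_of_lt h, neg_mul, mul_assoc]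

lemma ι_mul_ι_eq_bivector (x y : Fin 4 → R) :
    ι R x * ι R y = bivector (x 0 * y 1 - x 1 * y 0) (x 0 * y 2 - x 2 * y 0)
      (x 0 * y 3 - x 3 * y 0) (x 1 * y 2 - x 2 * y 1) (x 1 * y 3 - x 3 * y 1)
      (x 2 * y 3 - x 3 * y 2) := by
  have expand (v : Fin 4 → R) : ι R v = ∑ i, v i • stdGen R i := by
    simp_rw [stdGen, ← map_smul, ← map_sum]
    congr 1
    exact pi_eq_sum_univ' v
  rw [expand x, expand y]
  simp only [Fin.sum_univ_four, bivector, add_mul, mul_add, smul_mul_smul_comm,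
    stdGen_mul_self, stdGen_mul_of_lt, Fin.reduceLT]
  module

lemma exists_eq_bivector (w : ⋀[R]^2 (Fin 4 → R)) :
    ∃ a b c d f g : R, (w : ExteriorAlgebra R (Fin 4 → R)) = bivector a b c d f g := by
  obtain ⟨w, hw⟩ := w
  dsimp only
  rw [← ιMulti_span_fixedDegree] at hw
  induction hw using Submodule.span_induction with
  | mem x hx =>
    obtain ⟨v, rfl⟩ := hx
    refine ⟨_, _, _, _, _, _, Eq.trans ?_ (ι_mul_ι_eq_bivector (v 0) (v 1))⟩
    simp only [ιMulti_apply, List.ofFn_succ, List.ofFn_zero, List.prod_cons, List.prod_nil,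
      mul_one]
    rfl
  | zero => exact ⟨0, 0, 0, 0, 0, 0, by simp [bivector]⟩
  | add x y _ _ hx hy =>
    obtain ⟨a, b, c, d, f, g, hx⟩ := hx
    obtain ⟨a', b', c', d', f', g', hy⟩ := hy
    refine ⟨a + a', b + b', c + c', d + d', f + f', g + g', ?_⟩
    rw [hx, hy, bivector, bivector, bivector]
    module
  | smul r x _ hx =>
    obtain ⟨a, b, c, d, f, g, hx⟩ := hx
    refine ⟨r * a, r * b, r * c, r * d, r * f, r * g, ?_⟩
    rw [hx, bivector, bivector]
    module

/-- The standard generator `e₀ ∧ e₁ ∧ e₂ ∧ e₃` of `⋀⁴(R⁴)`. -/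
def volumeElement (R : Type*) [CommRing R] : ExteriorAlgebra R (Fin 4 → R) :=
  ιMulti R 4 fun i => Pi.single i 1

lemma minor_id_volumeElement : minor id (volumeElement R) = 1 := by
  rw [volumeElement, minor_ιMulti, ← Matrix.det_one (n := Fin 4)]
  congr 1
  ext i j
  simp [Matrix.one_apply, Pi.single_apply, eq_comm]

lemma bivector_mul_self (a b c d f g : R) :
    bivector a b c d f g * bivector a b c d f g =
      (2 * (a * g - b * f + c * d)) • volumeElement R := by
  have hvol : volumeElement R =
      stdGen R 0 * (stdGen R 1 * (stdGen R 2 * stdGen R 3)) := by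
    simp only [volumeElement, ιMulti_apply, List.ofFn_succ, List.ofFn_zero, List.prod_cons,
      List.prod_nil, mul_one]
    rfl
  rw [hvol]
  simp only [bivector, add_mul, mul_add, smul_mul_smul_comm, mul_assoc, stdGen_mul_self,
    stdGen_mul_stdGen_mul_self, stdGen_mul_of_lt, stdGen_mul_stdGen_mul_of_lt, Fin.reduceLT,
    mul_zero, mul_neg, neg_neg, neg_zero, smul_zero]
  module

lemma minor_bivector (i j : Fin 4) (a b c d f g : R) :
    minor ![i, j] (bivector a b c d f g) =
      a * minor ![i, j] (stdGen R 0 * stdGen R 1) + b * minor ![i, j] (stdGen R 0 * stdGen R 2) +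
      c * minor ![i, j] (stdGen R 0 * stdGen R 3) + d * minor ![i, j] (stdGen R 1 * stdGen R 2) +
      f * minor ![i, j] (stdGen R 1 * stdGen R 3) + g * minor ![i, j] (stdGen R 2 * stdGen R 3) := by
  simp [bivector]

/-- If a bivector in `R⁴` is decomposable, then its coordinates satisfy the Plücker relation. -/
lemma pluecker_of_bivector_eq_ι_mul_ι {a b c d f g : R} {x y : Fin 4 → R}
    (h : bivector a b c d f g = ι R x * ι R y) : a * g - b * f + c * d = 0 := by
  have key (i j : Fin 4) : minor ![i, j] (bivector a b c d f g) = x i * y j - x j * y i := by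
    rw [h, minor_ι_mul_ι]
  have h01 := key 0 1
  have h02 := key 0 2
  have h03 := key 0 3
  have h12 := key 1 2
  have h13 := key 1 3
  have h23 := key 2 3
  simp [minor_bivector, stdGen, minor_ι_mul_ι] at h01 h02 h03 h12 h13 h23
  rw [h01, h02, h03, h12, h13, h23]
  ring

/-- Over `ℤ/2`, the Plücker relation makes a bivector decomposable. -/
lemma exists_bivector_eq_ι_mul_ι {a b c d f g : ZMod 2} (h : a * g - b * f + c * d = 0) :
    ∃ x y : Fin 4 → ZMod 2, bivector a b c d f g = ι (ZMod 2) x * ι (ZMod 2) y := by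
  have key : ∀ a b c d f g : ZMod 2, a * g - b * f + c * d = 0 →
      ∃ x₀ x₁ x₂ x₃ y₀ y₁ y₂ y₃ : ZMod 2, a = x₀ * y₁ - x₁ * y₀ ∧ b = x₀ * y₂ - x₂ * y₀ ∧
        c = x₀ * y₃ - x₃ * y₀ ∧ d = x₁ * y₂ - x₂ * y₁ ∧ f = x₁ * y₃ - x₃ * y₁ ∧
        g = x₂ * y₃ - x₃ * y₂ := by
    decide +kernel
  obtain ⟨x₀, x₁, x₂, x₃, y₀, y₁, y₂, y₃, h₁, h₂, h₃, h₄, h₅, h₆⟩ := key a b c d f g h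
  refine ⟨![x₀, x₁, x₂, x₃], ![y₀, y₁, y₂, y₃], ?_⟩
  rw [ι_mul_ι_eq_bivector, h₁, h₂, h₃, h₄, h₅, h₆]
  rfl

end ExteriorAlgebra

open ExteriorAlgebra

lemma redEA_bivector (a b c d f g : ℤ) :
    redEA (bivector a b c d f g) = bivector (a : ZMod 2) b c d f g := by
  have hι (v : Fin 4 → ℤ) : redEA (ι ℤ v) = ι (ZMod 2) (red24 v) :=
    lift_ι_apply ℤ _ _ v
  have hred (i : Fin 4) : red24 (Pi.single i 1) = Pi.single i 1 := by
    ext j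
    by_cases hij : j = i <;> simp [red24, hij]
  simp [bivector, stdGen, hι, hred, Int.cast_smul_eq_zsmul]

/-- For `w ∈ ⋀²(ℤ⁴)`, the mod-2 reduction of `w` is decomposable in `⋀²((ℤ/2)⁴)` if and only
if `w ∧ w` lies in `4·⋀⁴(ℤ⁴)`. -/
theorem reduction_decomposable_iff_square_div_four (w : ⋀[ℤ]^2 (Fin 4 → ℤ)) :
    (∃ x y : Fin 4 → ZMod 2,
        redEA (w : ExteriorAlgebra ℤ (Fin 4 → ℤ)) =
          ExteriorAlgebra.ι (ZMod 2) x * ExteriorAlgebra.ι (ZMod 2) y) ↔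
      ∃ z : ⋀[ℤ]^4 (Fin 4 → ℤ),
        (w : ExteriorAlgebra ℤ (Fin 4 → ℤ)) * (w : ExteriorAlgebra ℤ (Fin 4 → ℤ)) =
          (4 : ℤ) • (z : ExteriorAlgebra ℤ (Fin 4 → ℤ)) := by
  obtain ⟨a, b, c, d, f, g, hw⟩ := exists_eq_bivector w
  have hmod : (a : ZMod 2) * g - b * f + c * d = 0 ↔ (2 : ℤ) ∣ a * g - b * f + c * d := by
    exact_mod_cast ZMod.intCast_zmod_eq_zero_iff_dvd (a * g - b * f + c * d) 2
  rw [hw, redEA_bivector, bivector_mul_self]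
  constructor
  · rintro ⟨x, y, h⟩
    obtain ⟨k, hk⟩ := hmod.mp (pluecker_of_bivector_eq_ι_mul_ι h)
    refine ⟨k • exteriorPower.ιMulti ℤ 4 fun i => Pi.single i 1, ?_⟩
    rw [hk, Submodule.coe_smul, exteriorPower.ιMulti_apply_coe, smul_smul, ← mul_assoc]
    rfl
  · rintro ⟨z, hz⟩
    have h := congrArg (minor id) hz
    rw [map_smul, map_smul, minor_id_volumeElement, smul_eq_mul, smul_eq_mul] at h
    exact exists_bivector_eq_ι_mul_ι (hmod.mpr ⟨minor id (z : ExteriorAlgebra ℤ _), by lia⟩)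
end
end
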